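/- arXiv:2502.04171 — 4 statements merged into one kernel-verified Lean document; each statement's English description precedes it below -/
import Mathlib

section
/- Let M be a finite functional causal model on a directed graph G = (V,E). For i ∈ {1,2}, let G_i ∈ F(G) be a classical teleportation graph with post-selection vertex set T^i, and let M_i be a teleportation fCM on G_i constructed from M. If the post-selection success probabilities are nonzero, then for every joint assignment x = {x_v ∈ X_v}_{v∈V}, the conditional probabilities agree: P_acyc(x | {t_T = 1}_{T∈T^1})_{G_1} = P_acyc(x | {t_T = 1}_{T∈T^2})_{G_2}. -/
open Finset

noncomputable section

/-- The Kronecker delta `δ_{x,y}` as a real number: `1` if `x = y` and `0` otherwise. -/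
def kron {α : Type*} (x y : α) : ℝ := by
  classical exact if x = y then 1 else 0

/-- A probability distribution on a finite type: values in `[0,1]` summing to `1`. -/
def IsProbDist {α : Type*} [Fintype α] (p : α → ℝ) : Prop :=
  (∀ a, 0 ≤ p a ∧ p a ≤ 1) ∧ ∑ a, p a = 1

/-- A directed graph (vertex type `V`, edge relation `E`) is acyclic if it contains no
directed cycle. -/
def Acyclic {V : Type*} (E : V → V → Prop) : Prop :=
  ∀ v, ¬ Relation.TransGen E v v

/-- A finite functional causal model (fCM) on a directed graph `G = (V, E)` with finite
vertex set: each vertex `v` carries a nonempty finite set `X v` of values, a finite set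
`U v` of error values with a probability distribution `pU v`, and a function
`f v : X_{pa(v)} × U_v → X_v` (the dependence on the parents `pa(v) = {w : E w v}` is
encoded by giving `f v` access to the values of all `w` with `E w v`). -/
structure FCM (V : Type) [Fintype V] [DecidableEq V] (E : V → V → Prop) where
  X : V → Type
  fintX : ∀ v, Fintype (X v)
  neX : ∀ v, Nonempty (X v)
  U : V → Type
  fintU : ∀ v, Fintype (U v)
  pU : ∀ v, U v → ℝ
  pU_mem : ∀ v u, 0 ≤ pU v u ∧ pU v u ≤ 1
  pU_sum : ∀ v, letI := fintU v; (∑ u, pU v u) = 1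
  f : ∀ v, (∀ w, E w v → X w) → U v → X v

attribute [instance] FCM.fintX FCM.neX FCM.fintU

variable {V : Type} [Fintype V] [DecidableEq V] {E : V → V → Prop}

/-- The number of solutions `N(u)` of an fCM for a valuation `u` of the error variables. -/
def FCM.Nsol (M : FCM V E) (u : ∀ v, M.U v) : ℝ :=
  ∑ x : ∀ v, M.X v, ∏ v, kron (M.f v (fun w _ => x w) (u v)) (x v)

/-- The average number of solutions `N̄ = Σ_u N(u) Π_v p^v(u_v)` of an fCM. -/
def FCM.Nbar (M : FCM V E) : ℝ :=
  ∑ u : ∀ v, M.U v, M.Nsol u * ∏ v, M.pU v (u v)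

/-- The data of a teleportation fCM on the classical teleportation graph `G^s` obtained from
an fCM `M` by splitting the vertices of `S`: for each split vertex `v ∈ S`, the
pre-selection vertex `R_v` carries the set `X v` with distribution `qC v`, and the
post-selection vertex `T_v` carries the set `{0,1}` with error set `B v` (distributed as
`qB v`) and function `τ v : X v × B v × X v → {0,1}`, such that `(τ v, qB v, qC v)` is a
classical post-selected teleportation protocol with success probability `lam v ∈ (0,1]`. -/
structure TeleProto {V : Type} [Fintype V] [DecidableEq V] {E : V → V → Prop}
    (M : FCM V E) (S : Finset V) where
  B : V → Type
  fintB : ∀ v, Fintype (B v)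
  qB : ∀ v, B v → ℝ
  qC : ∀ v, M.X v → ℝ
  tau : ∀ v, M.X v → B v → M.X v → Fin 2
  lam : V → ℝ
  qB_dist : ∀ v ∈ S, letI := fintB v; IsProbDist (qB v)
  qC_dist : ∀ v ∈ S, IsProbDist (qC v)
  lam_mem : ∀ v ∈ S, 0 < lam v ∧ lam v ≤ 1
  proto : ∀ v ∈ S, ∀ p : M.X v → ℝ, IsProbDist p → ∀ c : M.X v,
    letI := fintB v;
    (∑ a, ∑ b, p a * kron (tau v a b c) 1 * qB v b * qC v c) = lam v * p c

attribute [instance] TeleProto.fintB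

/-- The input to the functions of the teleportation fCM: for each split vertex `w ∈ S`, the
pre-selection vertex `R_w` (with value `r w`) substitutes `w` as input to the functions of
the children of `w`. -/
def teleArg (M : FCM V E) (S : Finset V)
    (x : ∀ v, M.X v) (r : ∀ v : {w // w ∈ S}, M.X v.1) : ∀ v, M.X v :=
  fun v => if h : v ∈ S then r ⟨v, h⟩ else x v

/-- The acyclic probability rule applied to the teleportation fCM: the joint probability
`P_acyc(x, r, t)_{G^s}` of values `x` on the original vertices, `r` on the pre-selection
vertices and `t` on the post-selection vertices. -/
def telePacyc (M : FCM V E) (S : Finset V) (T : TeleProto M S)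
    (x : ∀ v, M.X v) (r : ∀ v : {w // w ∈ S}, M.X v.1)
    (t : {w // w ∈ S} → Fin 2) : ℝ :=
  ∑ u : ∀ v, M.U v, ∑ b : ∀ v : {w // w ∈ S}, T.B v.1,
    (∏ v, M.pU v (u v) * kron (x v) (M.f v (fun w _ => teleArg M S x r w) (u v))) *
    ∏ v : {w // w ∈ S},
      T.qC v.1 (r v) * T.qB v.1 (b v) * kron (t v) (T.tau v.1 (x v.1) (b v) (r v))

/-- The post-selection success probability
`P_succ = P_acyc({t_{T_v} = 1}_{v ∈ S})_{G^s} = Σ_{x,r} P_acyc(x, r, {t_{T_v} = 1})_{G^s}`. -/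
def Psucc (M : FCM V E) (S : Finset V) (T : TeleProto M S) : ℝ :=
  ∑ x : ∀ v, M.X v, ∑ r : ∀ v : {w // w ∈ S}, M.X v.1,
    telePacyc M S T x r fun _ => 1

/-- The conditional probability `P_acyc(x | {t_T = 1}_{T ∈ 𝒯})_{G^s}` of a joint assignment
`x` on the original vertices given successful post-selection (the pre-selection values being
marginalized). -/
def Pcond (M : FCM V E) (S : Finset V) (T : TeleProto M S) (x : ∀ v, M.X v) : ℝ :=
  (∑ r : ∀ v : {w // w ∈ S}, M.X v.1, telePacyc M S T x r fun _ => 1) / Psucc M S T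

lemma kron_comm {α : Type*} (x y : α) : kron x y = kron y x := by
  by_cases h : x = y
  · rw [h]
  · simp [kron, h, Ne.symm h]

/-- A point mass is a probability distribution. -/
lemma isProbDist_kron {α : Type*} [Fintype α] (a : α) : IsProbDist (kron a) := by
  classical
  refine ⟨fun c => ?_, by simp [kron]⟩
  by_cases h : a = c <;> simp [kron, h]

/-- Successful post-selection identifies the input `a` with the pre-selected value `c`, up to
the factor `lam v`. -/
lemma TeleProto.sum_success (M : FCM V E) (S : Finset V) (T : TeleProto M S) {v : V}
    (hv : v ∈ S) (a c : M.X v) :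
    ∑ b, T.qC v c * T.qB v b * kron 1 (T.tau v a b c) = T.lam v * kron a c := by
  classical
  rw [← T.proto v hv (kron a) (isProbDist_kron a) c, Finset.sum_eq_single a]
  · refine Finset.sum_congr rfl fun b _ => ?_
    rw [kron_comm 1]
    simp only [kron, if_true]
    ring
  · intro a' _ h
    simp [kron, h.symm]
  · simp

lemma teleArg_self (M : FCM V E) (S : Finset V) (x : ∀ v, M.X v) :
    teleArg M S x (fun v => x v.1) = x := by
  funext v
  simp [teleArg]

lemma prod_kron {ι : Type*} [Fintype ι] {X : ι → Type*} (x r : ∀ i, X i) :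
    ∏ i, kron (x i) (r i) = kron x r := by
  classical
  simp only [kron, Finset.prod_ite_zero, funext_iff]
  simp

/-- The total weight `Σ_u Π_v p^v(u_v) δ_{x_v, f^v(x_{pa(v)}, u_v)}` of an assignment `x`. -/
def FCM.weight (M : FCM V E) (x : ∀ v, M.X v) : ℝ :=
  ∑ u : ∀ v, M.U v, ∏ v, M.pU v (u v) * kron (x v) (M.f v (fun w _ => x w) (u v))

/-- The joint probability of `x` and successful post-selection is the weight of `x` in the
original model, up to a factor independent of `x`. -/
lemma sum_telePacyc (M : FCM V E) (S : Finset V) (T : TeleProto M S) (x : ∀ v, M.X v) :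
    ∑ r : ∀ v : {w // w ∈ S}, M.X v.1, telePacyc M S T x r (fun _ => 1) =
      (∏ v : {w // w ∈ S}, T.lam v.1) * M.weight x := by
  classical
  have success (r : ∀ v : {w // w ∈ S}, M.X v.1) :
      ∑ b : ∀ v : {w // w ∈ S}, T.B v.1, ∏ v : {w // w ∈ S},
        T.qC v.1 (r v) * T.qB v.1 (b v) * kron 1 (T.tau v.1 (x v.1) (b v) (r v)) =
      (∏ v : {w // w ∈ S}, T.lam v.1) * kron (fun v : {w // w ∈ S} => x v.1) r := by
    rw [← prod_kron, ← Finset.prod_mul_distrib,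
      ← Fintype.prod_sum fun (v : {w // w ∈ S}) b =>
        T.qC v.1 (r v) * T.qB v.1 b * kron 1 (T.tau v.1 (x v.1) b (r v))]
    exact Finset.prod_congr rfl fun v _ => T.sum_success M S v.2 (x v.1) (r v)
  simp only [telePacyc, ← Finset.mul_sum, success, ← Finset.sum_mul]
  rw [Finset.sum_eq_single (fun v : {w // w ∈ S} => x v.1)]
  · simp only [teleArg_self, FCM.weight, kron, if_true]
    ring
  · intro r _ h
    simp [kron, h.symm]
  · simp

lemma Pcond_eq (M : FCM V E) (S : Finset V) (T : TeleProto M S) (x : ∀ v, M.X v) :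
    Pcond M S T x = M.weight x / ∑ y, M.weight y := by
  have h : ∏ v : {w // w ∈ S}, T.lam v.1 ≠ 0 :=
    Finset.prod_ne_zero_iff.mpr fun v _ => (T.lam_mem v.1 v.2).1.ne'
  simp only [Pcond, Psucc, sum_telePacyc, ← Finset.mul_sum]
  exact mul_div_mul_left _ _ h

/-- **equivalent probabilities from different classical teleportation graphs.**
Let `M` be a finite functional causal model on a directed graph `G = (V, E)`.  For
`i ∈ {1,2}`, let `G_i ∈ F(G)` be a classical teleportation graph with split vertex set `S_i`
(so that removing all outgoing edges of vertices in `S_i` yields an acyclic graph) and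
post-selection vertex set `𝒯^i`, and let `M_i` be a teleportation fCM on `G_i` constructed
from `M`.  If the post-selection success probabilities are nonzero, then for every joint
assignment `x = {x_v ∈ X_v}_{v∈V}` the conditional probabilities agree:
`P_acyc(x | {t_T = 1}_{T∈𝒯^1})_{G_1} = P_acyc(x | {t_T = 1}_{T∈𝒯^2})_{G_2}`. -/
theorem conditional_probabilities_independent_of_teleportation_graph
    {V : Type} [Fintype V] [DecidableEq V] {E : V → V → Prop}
    (M : FCM V E) (S1 S2 : Finset V)
    (hS1 : Acyclic fun a b : V => E a b ∧ a ∉ S1)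
    (hS2 : Acyclic fun a b : V => E a b ∧ a ∉ S2)
    (T1 : TeleProto M S1) (T2 : TeleProto M S2)
    (h1 : Psucc M S1 T1 ≠ 0) (h2 : Psucc M S2 T2 ≠ 0) :
    ∀ x : ∀ v, M.X v, Pcond M S1 T1 x = Pcond M S2 T2 x := by
  intro x
  rw [Pcond_eq, Pcond_eq]
end
end

section
/- If G = (V,E) is a directed acyclic graph with finite vertex set and V_1, V_2, V_3 are disjoint subsets of V with V_1, V_2 nonempty, then (V_1 ⊥^p V_2 | V_3)_G holds if and only if (V_1 ⊥^d V_2 | V_3)_G holds; i.e., p-separation reduces to d-separation on acyclic graphs. -/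
open Finset

noncomputable section

/-- An undirected path in a directed graph `E`: a duplicate-free list of vertices in which
consecutive vertices are joined by an edge in one direction or the other. -/
def IsUPath {V : Type*} (E : V → V → Prop) (p : List V) : Prop :=
  p.Chain' (fun x y => E x y ∨ E y x) ∧ p.Nodup

/-- A path `p` (given as a list of vertices) is blocked by a set `V₃` if it contains three
consecutive vertices `A, W, B` forming either a chain `A → W → B` (in either direction along
the path) with `W ∈ V₃`, a fork `A ← W → B` with `W ∈ V₃`, or a collider `A → W ← B` such
that neither `W` nor any descendant of `W` belongs to `V₃`. -/
def BlockedPath {V : Type*} (E : V → V → Prop) (V3 : Set V) (p : List V) : Prop :=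
  ∃ (l : List V) (A W B : V) (r : List V), p = l ++ A :: W :: B :: r ∧
    ((E A W ∧ E W B ∧ W ∈ V3) ∨
     (E B W ∧ E W A ∧ W ∈ V3) ∨
     (E W A ∧ E W B ∧ W ∈ V3) ∨
     (E A W ∧ E B W ∧ W ∉ V3 ∧ ∀ d, Relation.TransGen E W d → d ∉ V3))

/-- `d`-separation: `V₁` and `V₂` are `d`-separated given `V₃` if every (undirected) path
from a vertex of `V₁` to a vertex of `V₂` is blocked by `V₃` (in particular, if there is no
such path). -/
def DSep {V : Type*} (E : V → V → Prop) (V1 V2 V3 : Set V) : Prop :=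
  ∀ (p : List V) (A B : V), A ∈ V1 → B ∈ V2 → IsUPath E p →
    p.head? = some A → p.getLast? = some B → BlockedPath E V3 p

/-- The edge relation of the classical teleportation graph `G^s` built from a directed graph
`G = (V, E)` and a set `S ⊆ V` of split vertices.  Its vertices are `V ⊕ (S ⊕ S)`:
`Sum.inl v` is an original vertex, `Sum.inr (Sum.inl ⟨v,_⟩)` is the pre-selection vertex
`R_v`, and `Sum.inr (Sum.inr ⟨v,_⟩)` is the post-selection vertex `T_v`.  Its edges are the
original edges of `G` whose source is not split, the rerouted edges `(R_v, w)` for every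
child `w` of `v ∈ S` in `G`, and the new edges `(v, T_v)` and `(R_v, T_v)` for `v ∈ S`. -/
def teleE {V : Type*} (E : V → V → Prop) (S : Set V) :
    V ⊕ (↥S ⊕ ↥S) → V ⊕ (↥S ⊕ ↥S) → Prop
  | Sum.inl a, Sum.inl b => E a b ∧ a ∉ S
  | Sum.inr (Sum.inl rv), Sum.inl b => E rv.1 b
  | Sum.inl a, Sum.inr (Sum.inr tv) => a = tv.1
  | Sum.inr (Sum.inl rv), Sum.inr (Sum.inr tv) => rv.1 = tv.1
  | _, _ => False

/-- The set of post-selection vertices `𝒯 = {T_v}_{v∈S}` of the teleportation graph. -/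
def postVerts {V : Type*} (S : Set V) : Set (V ⊕ (↥S ⊕ ↥S)) :=
  Set.range fun tv : ↥S => Sum.inr (Sum.inr tv)

/-- `p`-separation: `(V₁ ⊥^p V₂ | V₃)_G` holds iff there exists a valid split set
`S ⊆ V` (i.e. one such that removing all outgoing edges of vertices in `S` yields an acyclic
graph) such that, in the associated classical teleportation graph `G^s`,
`(V₁ ⊥^d V₂ | V₃ ∪ 𝒯)_{G^s}` where `𝒯` is the set of post-selection vertices. -/
def PSep {V : Type*} (E : V → V → Prop) (V1 V2 V3 : Set V) : Prop :=
  ∃ S : Set V, (Acyclic fun a b => E a b ∧ a ∉ S) ∧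
    DSep (teleE E S) (Sum.inl '' V1) (Sum.inl '' V2)
      (Sum.inl '' V3 ∪ postVerts S)

/-- The vertices of the list `p` form an undirected path that is not blocked by `Z`. -/
def OpenPath {V : Type*} (E : V → V → Prop) (Z : Set V) (p : List V) : Prop :=
  IsUPath E p ∧ ¬ BlockedPath E Z p

theorem dsep_iff_not_openPath {V : Type*} {E : V → V → Prop} {V1 V2 V3 : Set V} :
    DSep E V1 V2 V3 ↔ ∀ (p : List V) (A B : V), A ∈ V1 → B ∈ V2 →
      p.head? = some A → p.getLast? = some B → ¬ OpenPath E V3 p := by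
  simp only [DSep, OpenPath]
  grind

theorem Acyclic.asymm {V : Type*} {E : V → V → Prop} (hE : Acyclic E) {a b : V}
    (hab : E a b) : ¬ E b a :=
  fun hba => hE a (.tail (.single hab) hba)

theorem blockedPath_cons_cons_cons {V : Type*} {E : V → V → Prop} {Z : Set V} {a w b : V}
    {p : List V} :
    BlockedPath E Z (a :: w :: b :: p) ↔
      ((E a w ∧ E w b ∧ w ∈ Z) ∨ (E b w ∧ E w a ∧ w ∈ Z) ∨ (E w a ∧ E w b ∧ w ∈ Z) ∨
        (E a w ∧ E b w ∧ w ∉ Z ∧ ∀ d, Relation.TransGen E w d → d ∉ Z)) ∨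
      BlockedPath E Z (w :: b :: p) := by
  constructor
  · rintro ⟨l, A, W, B, r, hp, h⟩
    cases l with
    | nil =>
      simp only [List.nil_append, List.cons.injEq] at hp
      obtain ⟨rfl, rfl, rfl, rfl⟩ := hp
      exact .inl h
    | cons x l =>
      simp only [List.cons_append, List.cons.injEq] at hp
      exact .inr ⟨l, A, W, B, r, hp.2, h⟩
  · rintro (h | ⟨l, A, W, B, r, hp, h⟩)
    · exact ⟨[], a, w, b, p, rfl, h⟩
    · exact ⟨a :: l, A, W, B, r, by rw [hp]; rfl, h⟩

theorem not_blockedPath_of_length_le_two {V : Type*} {E : V → V → Prop} {Z : Set V}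
    {p : List V} (hp : p.length ≤ 2) : ¬ BlockedPath E Z p := by
  rintro ⟨l, A, W, B, r, rfl, -⟩
  simp at hp
  omega

theorem isUPath_cons_cons {V : Type*} {E : V → V → Prop} {a b : V} {p : List V} :
    IsUPath E (a :: b :: p) ↔ (E a b ∨ E b a) ∧ a ∉ b :: p ∧ IsUPath E (b :: p) := by
  simp only [IsUPath, List.Chain', List.isChain_cons_cons, List.nodup_cons]
  tauto

theorem isUPath_singleton {V : Type*} {E : V → V → Prop} (a : V) : IsUPath E [a] := by
  simp [IsUPath, List.Chain']

theorem openPath_singleton {V : Type*} {E : V → V → Prop} {Z : Set V} (a : V) :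
    OpenPath E Z [a] :=
  ⟨isUPath_singleton a, not_blockedPath_of_length_le_two (by simp)⟩

theorem openPath_pair {V : Type*} {E : V → V → Prop} {Z : Set V} {a b : V}
    (hE : E a b ∨ E b a) (hab : a ≠ b) : OpenPath E Z [a, b] :=
  ⟨isUPath_cons_cons.2 ⟨hE, by simpa using hab, isUPath_singleton b⟩,
    not_blockedPath_of_length_le_two (by simp)⟩

/-- Extending an open path by a vertex so that its former first vertex becomes a non-collider. -/
theorem OpenPath.cons_of_not_mem {V : Type*} {E : V → V → Prop}
    (hE : ∀ a b, E a b → ¬ E b a) {Z : Set V} {a w b : V} {p : List V}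
    (h : OpenPath E Z (w :: b :: p)) (ha : a ∉ w :: b :: p) (haw : E a w ∨ E w a)
    (hout : E w a ∨ E w b) (hw : w ∉ Z) : OpenPath E Z (a :: w :: b :: p) := by
  refine ⟨isUPath_cons_cons.2 ⟨haw, ha, h.1⟩, fun hb => ?_⟩
  have := hE w a
  have := hE w b
  rcases blockedPath_cons_cons_cons.1 hb with hb | hb
  · tauto
  · exact h.2 hb

theorem OpenPath.cons_of_edge {V : Type*} {E : V → V → Prop}
    (hE : ∀ a b, E a b → ¬ E b a) {Z : Set V} {a w : V} {p : List V}
    (h : OpenPath E Z (w :: p)) (ha : a ∉ w :: p) (hwa : E w a) (hw : w ∉ Z) :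
    OpenPath E Z (a :: w :: p) := by
  cases p with
  | nil => exact openPath_pair (.inr hwa) (by simpa using ha)
  | cons b p => exact h.cons_of_not_mem hE ha (.inr hwa) (.inl hwa) hw

/-- Extending an open path by a vertex so that its former first vertex becomes a collider. -/
theorem OpenPath.cons_of_collider {V : Type*} {E : V → V → Prop}
    (hE : ∀ a b, E a b → ¬ E b a) {Z : Set V} {a w b : V} {p : List V}
    (h : OpenPath E Z (w :: b :: p)) (ha : a ∉ w :: b :: p) (haw : E a w) (hbw : E b w)
    (hw : ∃ d ∈ Z, Relation.ReflTransGen E w d) : OpenPath E Z (a :: w :: b :: p) := by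
  refine ⟨isUPath_cons_cons.2 ⟨.inl haw, ha, h.1⟩, fun hb => ?_⟩
  have h₁ := hE a w haw
  have h₂ := hE b w hbw
  rcases blockedPath_cons_cons_cons.1 hb with hb | hb
  · obtain ⟨d, hd, hwd⟩ := hw
    rcases Relation.reflTransGen_iff_eq_or_transGen.1 hwd with rfl | hwd
    · tauto
    · have hnot : ¬ ∀ d, Relation.TransGen E w d → d ∉ Z :=
        fun hall => hall d hwd hd
      tauto
  · exact h.2 hb

theorem OpenPath.tail {V : Type*} {E : V → V → Prop} {Z : Set V} {a w b : V} {p : List V}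
    (h : OpenPath E Z (a :: w :: b :: p)) : OpenPath E Z (w :: b :: p) :=
  ⟨(isUPath_cons_cons.1 h.1).2.2, fun hb => h.2 (blockedPath_cons_cons_cons.2 (.inr hb))⟩

theorem OpenPath.not_mem {V : Type*} {E : V → V → Prop} {Z : Set V} {a w b : V} {p : List V}
    (h : OpenPath E Z (a :: w :: b :: p)) (hout : E w a ∨ E w b) : w ∉ Z := by
  intro hw
  have h₁ := (isUPath_cons_cons.1 h.1).1
  have h₂ := (isUPath_cons_cons.1 h.tail.1).1
  exact h.2 (blockedPath_cons_cons_cons.2 (.inl (by tauto)))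

theorem OpenPath.exists_reflTransGen {V : Type*} {E : V → V → Prop} {Z : Set V} {a w b : V}
    {p : List V} (h : OpenPath E Z (a :: w :: b :: p)) (haw : E a w) (hbw : E b w) :
    ∃ d ∈ Z, Relation.ReflTransGen E w d := by
  by_contra! hcon
  exact h.2 (blockedPath_cons_cons_cons.2 (.inl (.inr (.inr (.inr
    ⟨haw, hbw, fun hw => hcon w hw .refl, fun d hd hdZ => hcon d hdZ hd.to_reflTransGen⟩)))))

section Teleportation

variable {V : Type*} {E : V → V → Prop} {S : Set V}

/-- The original vertex from which a vertex of the teleportation graph arises. -/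
def teleBase (S : Set V) : V ⊕ (↥S ⊕ ↥S) → V
  | .inl v => v
  | .inr (.inl v) => v
  | .inr (.inr v) => v

open Classical in
/-- The vertex of the teleportation graph that carries the outgoing edges of `v`. -/
def teleOut (S : Set V) (v : V) : V ⊕ (↥S ⊕ ↥S) :=
  if h : v ∈ S then .inr (.inl ⟨v, h⟩) else .inl v

@[simp] theorem teleBase_teleOut (v : V) : teleBase S (teleOut S v) = v := by
  unfold teleOut; split <;> rfl

theorem teleOut_of_not_mem {v : V} (h : v ∉ S) : teleOut S v = .inl v := dif_neg h

theorem teleOut_of_mem {v : V} (h : v ∈ S) : teleOut S v = .inr (.inl ⟨v, h⟩) := dif_pos h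

theorem teleE_teleOut_inl {a b : V} (h : E a b) : teleE E S (teleOut S a) (.inl b) := by
  unfold teleOut; split
  · exact h
  · exact ⟨h, ‹_›⟩

theorem teleE_asymm (hE : Acyclic E) (x y : V ⊕ (↥S ⊕ ↥S)) (h : teleE E S x y) :
    ¬ teleE E S y x := by
  rcases x with x | x | x <;> rcases y with y | y | y <;> simp only [teleE] at h ⊢ <;>
    first | exact not_false | skip
  exact fun h' => hE.asymm h.1 h'.1

theorem teleOut_not_mem {Z : Set V} {v : V} (hv : v ∉ Z) :
    teleOut S v ∉ (Sum.inl '' Z ∪ postVerts S : Set (V ⊕ (↥S ⊕ ↥S))) := by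
  unfold teleOut; split <;> simp [postVerts, hv]

/-- A vertex with a descendant in `Z` has, in the teleportation graph, a descendant in `Z` or
among the post-selection vertices. -/
theorem exists_reflTransGen_teleE {Z : Set V} {w d : V} (hd : d ∈ Z)
    (h : Relation.ReflTransGen E w d) :
    ∃ x ∈ (Sum.inl '' Z ∪ postVerts S : Set (V ⊕ (↥S ⊕ ↥S))),
      Relation.ReflTransGen (teleE E S) (.inl w) x := by
  induction h using Relation.ReflTransGen.head_induction_on with
  | refl => exact ⟨.inl d, .inl ⟨d, hd, rfl⟩, .refl⟩
  | @head a c hac _ ih =>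
    by_cases ha : a ∈ S
    · exact ⟨.inr (.inr ⟨a, ha⟩), .inr ⟨⟨a, ha⟩, rfl⟩, .single rfl⟩
    · obtain ⟨x, hx, hcx⟩ := ih
      exact ⟨x, hx, .head (show teleE E S (.inl a) (.inl c) from ⟨hac, ha⟩) hcx⟩

/-- `x :: q` is an open path in the teleportation graph that ends in `t` and that, after its
first vertex, only uses vertices arising from those in `p`. -/
def TeleLift (E : V → V → Prop) (S Z : Set V) (t : V) (x : V ⊕ (↥S ⊕ ↥S))
    (q : List (V ⊕ (↥S ⊕ ↥S))) (p : List V) : Prop :=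
  OpenPath (teleE E S) (Sum.inl '' Z ∪ postVerts S) (x :: q) ∧
    (x :: q).getLast? = some (.inl t) ∧ ∀ z ∈ q, teleBase S z ∈ p

variable {Z : Set V} {t : V}

theorem TeleLift.not_mem {x y : V ⊕ (↥S ⊕ ↥S)} {q : List (V ⊕ (↥S ⊕ ↥S))} {p : List V}
    (h : TeleLift E S Z t y q p) (hx : teleBase S x ∉ p) (hxy : x ≠ y) : x ∉ y :: q := by
  rw [List.mem_cons, not_or]
  exact ⟨hxy, fun hq => hx (h.2.2 x hq)⟩

theorem TeleLift.cons {x y : V ⊕ (↥S ⊕ ↥S)} {q : List (V ⊕ (↥S ⊕ ↥S))} {p p' : List V}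
    (h : TeleLift E S Z t y q p)
    (hx : OpenPath (teleE E S) (Sum.inl '' Z ∪ postVerts S) (x :: y :: q))
    (hy : teleBase S y ∈ p') (hp : p ⊆ p') : TeleLift E S Z t x (y :: q) p' := by
  refine ⟨hx, by simpa using h.2.1, ?_⟩
  simp only [List.mem_cons, forall_eq_or_imp]
  exact ⟨hy, fun z hz => hp (h.2.2 z hz)⟩

/-- Going from the vertex `v` to the vertex carrying its outgoing edges, through the
post-selection vertex if `v` is split. -/
theorem TeleLift.exists_inl (hE : Acyclic E) {v : V} {p : List V} {y : V ⊕ (↥S ⊕ ↥S)}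
    {q : List (V ⊕ (↥S ⊕ ↥S))} (hvp : v ∉ p) (h : TeleLift E S Z t (teleOut S v) (y :: q) p)
    (hy : teleE E S (teleOut S v) y) :
    ∃ y' q', TeleLift E S Z t (.inl v) (y' :: q') (v :: p) ∧ teleE E S (.inl v) y' := by
  by_cases hS : v ∈ S
  · rw [teleOut_of_mem hS] at h
    have hT := h.cons (p' := v :: p) (x := .inr (.inr ⟨v, hS⟩))
      (h.1.cons_of_edge (teleE_asymm hE) (h.not_mem hvp (by simp)) rfl (by simp [postVerts]))
      (.head _) (List.subset_cons_self v p)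
    have hne : Sum.inl v ∉ Sum.inr (Sum.inr ⟨v, hS⟩) :: Sum.inr (Sum.inl ⟨v, hS⟩) :: y :: q :=
      List.not_mem_cons_of_ne_of_not_mem (by simp) (h.not_mem hvp (by simp))
    exact ⟨_, _, hT.cons (hT.1.cons_of_collider (teleE_asymm hE) hne rfl rfl
      ⟨_, .inr ⟨⟨v, hS⟩, rfl⟩, .refl⟩) (.head _) (List.Subset.refl _), rfl⟩
  · rw [teleOut_of_not_mem hS] at h hy
    exact ⟨y, q, ⟨h.1, h.2.1, fun z hz => .tail _ (h.2.2 z hz)⟩, hy⟩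

/-- Going from the vertex carrying the outgoing edges of `v` to `v`, through the
post-selection vertex if `v` is split. -/
theorem TeleLift.exists_teleOut (hE : Acyclic E) {v : V} {p : List V}
    {q : List (V ⊕ (↥S ⊕ ↥S))} (hv : v ∉ Z) (hvp : v ∉ p)
    (h : TeleLift E S Z t (.inl v) q p) :
    ∃ q', TeleLift E S Z t (teleOut S v) q' (v :: p) := by
  by_cases hS : v ∈ S
  · rw [teleOut_of_mem hS]
    have hT := h.cons (p' := v :: p) (x := .inr (.inr ⟨v, hS⟩))
      (h.1.cons_of_edge (teleE_asymm hE) (h.not_mem hvp (by simp)) rfl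
        (by simp [postVerts, hv])) (.head _) (List.subset_cons_self v p)
    have hne : Sum.inr (Sum.inl ⟨v, hS⟩) ∉ Sum.inr (Sum.inr ⟨v, hS⟩) :: Sum.inl v :: q :=
      List.not_mem_cons_of_ne_of_not_mem (by simp) (h.not_mem hvp (by simp))
    exact ⟨_, hT.cons (hT.1.cons_of_collider (teleE_asymm hE) hne rfl rfl
      ⟨_, .inr ⟨⟨v, hS⟩, rfl⟩, .refl⟩) (.head _) (List.Subset.refl _)⟩
  · rw [teleOut_of_not_mem hS]
    exact ⟨q, h.1, h.2.1, fun z hz => .tail _ (h.2.2 z hz)⟩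

/-- An open path with at least one edge lifts to the teleportation graph. -/
theorem OpenPath.exists_teleLift (hE : Acyclic E) (ht : t ∉ Z) {a b : V} {p : List V}
    (h : OpenPath E Z (a :: b :: p)) (hlast : (a :: b :: p).getLast? = some t) :
    (E a b → ∃ y q, TeleLift E S Z t (teleOut S a) (y :: q) (b :: p) ∧
      teleE E S (teleOut S a) y) ∧
    (E b a → ∃ y q, TeleLift E S Z t (.inl a) (y :: q) (b :: p) ∧
      teleE E S y (.inl a)) := by
  have hab : a ∉ b :: p := (isUPath_cons_cons.1 h.1).2.1
  have ne_of_base {x y : V ⊕ (↥S ⊕ ↥S)} (hx : teleBase S x = a) (hy : teleBase S y = b) :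
      x ≠ y := by
    rintro rfl
    exact hab (hx ▸ hy ▸ .head _)
  induction p generalizing a b with
  | nil =>
    obtain rfl : b = t := by simpa using hlast
    have hb : TeleLift E S Z b (.inl b) [] [] := ⟨openPath_singleton _, rfl, by simp⟩
    refine ⟨fun e => ⟨_, _, hb.cons (openPath_pair (.inl (teleE_teleOut_inl e))
      (ne_of_base (teleBase_teleOut a) rfl)) (.head _) (by simp), teleE_teleOut_inl e⟩,
      fun e => ?_⟩
    obtain ⟨q, hq⟩ := hb.exists_teleOut hE ht (by simp)
    exact ⟨_, _, hq.cons (hq.1.cons_of_edge (teleE_asymm hE)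
      (hq.not_mem hab (ne_of_base rfl (teleBase_teleOut b))) (teleE_teleOut_inl e)
      (teleOut_not_mem ht)) (by simp) (List.Subset.refl _), teleE_teleOut_inl e⟩
  | cons c p ih =>
    have hbc : b ∉ c :: p := (isUPath_cons_cons.1 h.tail.1).2.1
    have hac : a ∉ c :: p := fun hmem => hab (.tail _ hmem)
    have hsub : c :: p ⊆ b :: c :: p := List.subset_cons_self _ _
    obtain ⟨ihout, ihin⟩ := ih h.tail (by simpa using hlast) hbc
      (by rintro x y hx hy rfl; exact hbc (hx ▸ hy ▸ .head _))
    rcases (isUPath_cons_cons.1 h.tail.1).1 with hbc' | hcb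
    · have hbZ : b ∉ Z := h.not_mem (.inr hbc')
      obtain ⟨y, q, hq, hy⟩ := ihout hbc'
      refine ⟨fun e => ?_, fun e => ?_⟩
      · obtain ⟨y', q', hq', hy'⟩ := hq.exists_inl hE hbc hy
        exact ⟨_, _, hq'.cons (hq'.1.cons_of_not_mem (teleE_asymm hE)
          (hq'.not_mem (by simpa using hab) (ne_of_base (teleBase_teleOut a) rfl))
          (.inl (teleE_teleOut_inl e)) (.inr hy') (by simp [postVerts, hbZ])) (.head _)
          (List.Subset.refl _), teleE_teleOut_inl e⟩
      · exact ⟨_, _, hq.cons (hq.1.cons_of_edge (teleE_asymm hE)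
          (hq.not_mem hac (ne_of_base rfl (teleBase_teleOut b))) (teleE_teleOut_inl e)
          (teleOut_not_mem hbZ)) (by simp) hsub, teleE_teleOut_inl e⟩
    · obtain ⟨y, q, hq, hy⟩ := ihin hcb
      refine ⟨fun e => ?_, fun e => ?_⟩
      · obtain ⟨d, hd, hbd⟩ := h.exists_reflTransGen e hcb
        exact ⟨_, _, hq.cons (hq.1.cons_of_collider (teleE_asymm hE)
          (hq.not_mem (by simpa using hac) (ne_of_base (teleBase_teleOut a) rfl))
          (teleE_teleOut_inl e) hy (exists_reflTransGen_teleE hd hbd)) (.head _) hsub,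
          teleE_teleOut_inl e⟩
      · have hbZ : b ∉ Z := h.not_mem (.inl e)
        obtain ⟨q', hq'⟩ := hq.exists_teleOut hE hbZ hbc
        exact ⟨_, _, hq'.cons (hq'.1.cons_of_edge (teleE_asymm hE)
          (hq'.not_mem hab (ne_of_base rfl (teleBase_teleOut b))) (teleE_teleOut_inl e)
          (teleOut_not_mem hbZ)) (by simp) (List.Subset.refl _), teleE_teleOut_inl e⟩

/-- Splitting vertices of an acyclic graph does not create new `d`-separations. -/
theorem dsep_of_dsep_teleE (hE : Acyclic E) {V1 V2 V3 : Set V} (h23 : Disjoint V2 V3)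
    (h : DSep (teleE E S) (Sum.inl '' V1) (Sum.inl '' V2) (Sum.inl '' V3 ∪ postVerts S)) :
    DSep E V1 V2 V3 := by
  rw [dsep_iff_not_openPath] at h ⊢
  intro p A B hA hB hhead hlast hp
  have hA' : (Sum.inl A : V ⊕ (↥S ⊕ ↥S)) ∈ Sum.inl '' V1 := ⟨A, hA, rfl⟩
  have hB' : (Sum.inl B : V ⊕ (↥S ⊕ ↥S)) ∈ Sum.inl '' V2 := ⟨B, hB, rfl⟩
  match p, hhead with
  | [_], rfl =>
    obtain rfl : A = B := by simpa using hlast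
    exact h [.inl A] _ _ hA' hB' rfl rfl (openPath_singleton _)
  | _ :: b :: p, rfl =>
    obtain ⟨hout, hin⟩ := hp.exists_teleLift (S := S) hE (h23.notMem_of_mem_left hB) hlast
    obtain ⟨hAb, hAp, -⟩ := isUPath_cons_cons.1 hp.1
    rcases hAb with e | e
    · obtain ⟨y, q, hq, hy⟩ := hout e
      obtain ⟨y', q', hq', -⟩ := hq.exists_inl hE hAp hy
      exact h _ _ _ hA' hB' rfl hq'.2.1 hq'.1
    · obtain ⟨y, q, hq, -⟩ := hin e
      exact h _ _ _ hA' hB' rfl hq.2.1 hq.1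

end Teleportation

section EmptySplit

variable {V : Type*} {E : V → V → Prop}

theorem inl_teleBase_empty (x : V ⊕ (↥(∅ : Set V) ⊕ ↥(∅ : Set V))) :
    Sum.inl (teleBase ∅ x) = x := by
  rcases x with x | x | x
  · rfl
  · exact x.2.elim
  · exact x.2.elim

theorem teleE_empty_inl_iff {a b : V} : teleE E ∅ (.inl a) (.inl b) ↔ E a b := by
  simp [teleE]

theorem teleE_empty_iff {x y : V ⊕ (↥(∅ : Set V) ⊕ ↥(∅ : Set V))} :
    teleE E ∅ x y ↔ E (teleBase ∅ x) (teleBase ∅ y) := by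
  rw [← inl_teleBase_empty x, ← inl_teleBase_empty y]
  exact teleE_empty_inl_iff

theorem mem_image_inl_union_postVerts_empty {Z : Set V}
    {x : V ⊕ (↥(∅ : Set V) ⊕ ↥(∅ : Set V))} :
    x ∈ Sum.inl '' Z ∪ postVerts ∅ ↔ teleBase ∅ x ∈ Z := by
  rw [← inl_teleBase_empty x]
  simp [postVerts, teleBase]

theorem dsep_teleE_empty {V1 V2 V3 : Set V} (h : DSep E V1 V2 V3) :
    DSep (teleE E ∅) (Sum.inl '' V1) (Sum.inl '' V2) (Sum.inl '' V3 ∪ postVerts ∅) := by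
  rintro p _ _ ⟨A, hA, rfl⟩ ⟨B, hB, rfl⟩ hp hhead hlast
  obtain ⟨p, rfl⟩ : ∃ p₀ : List V, p = p₀.map Sum.inl :=
    ⟨p.map (teleBase ∅), by simp [Function.comp_def, inl_teleBase_empty]⟩
  have hpath : IsUPath E p := by
    refine ⟨?_, hp.2.of_map _⟩
    have hchain := hp.1
    simp only [List.Chain', List.isChain_map, teleE_empty_inl_iff] at hchain
    exact hchain
  obtain ⟨l, a, w, b, r, rfl, hb⟩ := h p A B hA hB hpath (by simpa using hhead)
    (by simpa using hlast)
  refine ⟨l.map .inl, .inl a, .inl w, .inl b, r.map .inl, by simp, ?_⟩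
  simp only [teleE_empty_inl_iff, mem_image_inl_union_postVerts_empty]
  refine hb.imp_right (.imp_right (.imp_right ?_))
  rintro ⟨haw, hbw, hw, hd⟩
  exact ⟨haw, hbw, hw, fun d hwd => hd _ (hwd.lift (teleBase ∅) fun _ _ => teleE_empty_iff.1)⟩

end EmptySplit

/-- If `G = (V, E)` is a directed acyclic graph with finite vertex set and
`V₁, V₂, V₃` are disjoint subsets of `V` with `V₁, V₂` nonempty, then
`(V₁ ⊥^p V₂ | V₃)_G` holds if and only if `(V₁ ⊥^d V₂ | V₃)_G` holds: `p`-separation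
reduces to `d`-separation on acyclic graphs. -/
theorem psep_iff_dsep_of_acyclic
    {V : Type} [Fintype V] (E : V → V → Prop) (hG : Acyclic E)
    (V1 V2 V3 : Set V)
    (h12 : Disjoint V1 V2) (h13 : Disjoint V1 V3) (h23 : Disjoint V2 V3)
    (h1 : V1.Nonempty) (h2 : V2.Nonempty) :
    PSep E V1 V2 V3 ↔ DSep E V1 V2 V3 := by
  constructor
  · rintro ⟨S, -, h⟩
    exact dsep_of_dsep_teleE hG h23 h
  · exact fun h => ⟨∅, by simpa using hG, dsep_teleE_empty h⟩
end
end

section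
/- (Perfect correlation of exogenous inputs to a XOR loop.) Let p_3, p_4 be probability distributions on {0,1} with Σ_{y∈{0,1}} p_3(y) p_4(y) ≠ 0. Then for all x_3, x_4 ∈ {0,1}: (Σ_{x_1,x_2∈{0,1}} p_3(x_3) p_4(x_4) δ_{x_1, x_2⊕x_3} δ_{x_2, x_1⊕x_4}) / (Σ_{y_1,y_2,y_3,y_4∈{0,1}} p_3(y_3) p_4(y_4) δ_{y_1, y_2⊕y_3} δ_{y_2, y_1⊕y_4}) = p_3(x_3) p_4(x_4) δ_{x_3,x_4} / (Σ_{y∈{0,1}} p_3(y) p_4(y)). In particular this distribution vanishes whenever x_3 ≠ x_4, so x_3 and x_4 are perfectly correlated even though the corresponding vertices v_3 and v_4 are d-separated in the underlying cyclic graph. -/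
open Finset

noncomputable section

theorem kron_eq_ite {α : Type*} [DecidableEq α] (x y : α) :
    kron x y = if x = y then 1 else 0 := by
  unfold kron
  congr

/-- The XOR loop has two solutions when its inputs agree and none otherwise. -/
theorem sum_kron_xor_loop (a b : ZMod 2) :
    ∑ x : ZMod 2, ∑ y : ZMod 2, kron x (y + a) * kron y (x + b) = 2 * kron a b := by
  have key : ∀ y : ZMod 2, y = y + a + b ↔ a = b := by
    revert a b
    decide
  rw [Finset.sum_comm]
  simp only [kron_eq_ite, ite_mul, one_mul, zero_mul, Finset.sum_ite_eq',
    Finset.mem_univ, if_true, key]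
  simp

theorem sum_mul_kron_xor_loop (c : ℝ) (a b : ZMod 2) :
    ∑ x : ZMod 2, ∑ y : ZMod 2, c * kron x (y + a) * kron y (x + b) = 2 * (c * kron a b) := by
  simp only [mul_assoc, ← Finset.mul_sum, sum_kron_xor_loop]
  ring

theorem normalization_xor_loop (p q : ZMod 2 → ℝ) :
    ∑ x : ZMod 2, ∑ y : ZMod 2, ∑ a : ZMod 2, ∑ b : ZMod 2,
      p a * q b * kron x (y + a) * kron y (x + b) = 2 * ∑ a : ZMod 2, p a * q a := by
  calc
    _ = ∑ a : ZMod 2, ∑ b : ZMod 2, ∑ x : ZMod 2, ∑ y : ZMod 2,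
        p a * q b * kron x (y + a) * kron y (x + b) := by
      rw [Finset.sum_congr rfl fun x _ => Finset.sum_comm, Finset.sum_comm]
      refine Finset.sum_congr rfl fun a _ => ?_
      rw [Finset.sum_congr rfl fun x _ => Finset.sum_comm, Finset.sum_comm]
    _ = 2 * ∑ a : ZMod 2, p a * q a := by
      simp only [sum_mul_kron_xor_loop, ← Finset.mul_sum]
      simp [kron_eq_ite]

/-- **perfect correlation of exogenous inputs to a XOR loop.**
Let `p₃, p₄` be probability distributions on `{0,1}` (formalized as `ZMod 2`, so that `+` is
`⊕`, addition modulo 2) with `Σ_y p₃(y) p₄(y) ≠ 0`.  Then for all `x₃, x₄ ∈ {0,1}`, the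
marginal of the cyclic model with functions `x₁ = x₂ ⊕ x₃`, `x₂ = x₁ ⊕ x₄` satisfies
`(Σ_{x₁,x₂} p₃(x₃) p₄(x₄) δ_{x₁,x₂⊕x₃} δ_{x₂,x₁⊕x₄}) / (Σ_{y₁,y₂,y₃,y₄} p₃(y₃) p₄(y₄) δ_{y₁,y₂⊕y₃} δ_{y₂,y₁⊕y₄})`
`= p₃(x₃) p₄(x₄) δ_{x₃,x₄} / (Σ_y p₃(y) p₄(y))`;
in particular this vanishes whenever `x₃ ≠ x₄`, so `x₃` and `x₄` are perfectly correlated. -/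
theorem xor_loop_perfect_correlation
    (p3 p4 : ZMod 2 → ℝ) (hp3 : IsProbDist p3) (hp4 : IsProbDist p4)
    (hne : ∑ y : ZMod 2, p3 y * p4 y ≠ 0) :
    ∀ x3 x4 : ZMod 2,
      (∑ x1 : ZMod 2, ∑ x2 : ZMod 2,
          p3 x3 * p4 x4 * kron x1 (x2 + x3) * kron x2 (x1 + x4)) /
        (∑ y1 : ZMod 2, ∑ y2 : ZMod 2, ∑ y3 : ZMod 2, ∑ y4 : ZMod 2,
          p3 y3 * p4 y4 * kron y1 (y2 + y3) * kron y2 (y1 + y4))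
        = p3 x3 * p4 x4 * kron x3 x4 / (∑ y : ZMod 2, p3 y * p4 y) ∧
      (x3 ≠ x4 →
        (∑ x1 : ZMod 2, ∑ x2 : ZMod 2,
            p3 x3 * p4 x4 * kron x1 (x2 + x3) * kron x2 (x1 + x4)) /
          (∑ y1 : ZMod 2, ∑ y2 : ZMod 2, ∑ y3 : ZMod 2, ∑ y4 : ZMod 2,
            p3 y3 * p4 y4 * kron y1 (y2 + y3) * kron y2 (y1 + y4)) = 0) := by
  intro x3 x4
  rw [sum_mul_kron_xor_loop, normalization_xor_loop, mul_div_mul_left _ _ two_ne_zero]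
  exact ⟨rfl, fun h => by simp [kron_eq_ite, h]⟩
end
end

section
/- (Unique solvability of Neal's model.) For every (u_1, u_4, u_5) ∈ {0,1}^3 there is exactly one tuple (x_1, x_2, x_3, x_4, x_5, x_6, x_7) ∈ {0,1}^7 satisfying simultaneously: x_1 = u_1, x_2 = x_1 ⊕ x_3, x_3 = x_1 ⊕ x_2, x_4 = u_4, x_5 = u_5, x_6 = (x_2 ⊕ x_4 ⊕ x_5) · (x_7 ⊕ 1), and x_7 = (x_2 ⊕ x_4 ⊕ x_5) · x_6, where ⊕ is addition modulo 2 and · is multiplication in {0,1}. Moreover, this unique solution satisfies x_2 ⊕ x_4 ⊕ x_5 = 0 and x_6 = x_7 = 0. -/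
noncomputable section

/-- The feedback loop `a = s(b + 1)`, `b = sa` over `ZMod 2` is only consistent when `s = 0`. -/
theorem neal_feedback_eq_zero :
    ∀ s a b : ZMod 2, a = s * (b + 1) → b = s * a → s = 0 ∧ a = 0 ∧ b = 0 := by
  decide

/-- **unique solvability of Neal's model.**
Working in `{0,1}` formalized as `ZMod 2` (where `+` is `⊕`, addition modulo 2, and `*` is
multiplication, which on `{0,1}` agrees with integer multiplication): for every
`(u₁, u₄, u₅) ∈ {0,1}³` there is exactly one tuple `(x₁, …, x₇) ∈ {0,1}⁷` (formalized as
`x : Fin 7 → ZMod 2`, with `x i` standing for `x_{i+1}`) satisfying simultaneously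
`x₁ = u₁`, `x₂ = x₁ ⊕ x₃`, `x₃ = x₁ ⊕ x₂`, `x₄ = u₄`, `x₅ = u₅`,
`x₆ = (x₂ ⊕ x₄ ⊕ x₅)·(x₇ ⊕ 1)` and `x₇ = (x₂ ⊕ x₄ ⊕ x₅)·x₆`.
Moreover, every solution satisfies `x₂ ⊕ x₄ ⊕ x₅ = 0` and `x₆ = x₇ = 0`. -/
theorem neal_model_uniquely_solvable :
    ∀ u1 u4 u5 : ZMod 2,
      (∃! x : Fin 7 → ZMod 2,
        x 0 = u1 ∧
        x 1 = x 0 + x 2 ∧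
        x 2 = x 0 + x 1 ∧
        x 3 = u4 ∧
        x 4 = u5 ∧
        x 5 = (x 1 + x 3 + x 4) * (x 6 + 1) ∧
        x 6 = (x 1 + x 3 + x 4) * x 5) ∧
      (∀ x : Fin 7 → ZMod 2,
        (x 0 = u1 ∧
         x 1 = x 0 + x 2 ∧
         x 2 = x 0 + x 1 ∧
         x 3 = u4 ∧
         x 4 = u5 ∧
         x 5 = (x 1 + x 3 + x 4) * (x 6 + 1) ∧
         x 6 = (x 1 + x 3 + x 4) * x 5) →
        (x 1 + x 3 + x 4 = 0 ∧ x 5 = 0 ∧ x 6 = 0)) := by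
  intro u1 u4 u5
  refine ⟨⟨![u1, u4 + u5, u1 + (u4 + u5), u4, u5, 0, 0], ?_, ?_⟩, ?_⟩
  · have hsol : ∀ a b c : ZMod 2,
        b + c = a + (a + (b + c)) ∧ 0 = (b + c + b + c) * (0 + 1) := by decide
    exact ⟨rfl, (hsol u1 u4 u5).1, rfl, rfl, rfl, (hsol u1 u4 u5).2, (mul_zero _).symm⟩
  · rintro y ⟨h0, -, h2, h3, h4, h5, h6⟩
    obtain ⟨hs, h5, h6⟩ := neal_feedback_eq_zero _ _ _ h5 h6
    have h1 : y 1 = u4 + u5 := by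
      rw [h3, h4, add_assoc] at hs
      exact CharTwo.add_eq_zero.mp hs
    rw [h0, h1] at h2
    ext i
    fin_cases i
    exacts [h0, h1, h2, h3, h4, h5, h6]
  · rintro x ⟨-, -, -, -, -, h5, h6⟩
    exact neal_feedback_eq_zero _ _ _ h5 h6
end
end
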